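/- Let E be a seminormed real vector space, K ≥ 1 a natural number, and for t ∈ {0,1} let g_0^t, …, g_{K-1}^t and q_1^t, …, q_K^t be elements of E (where g_{k-1}^t plays the role of the Bellman update Γ*Q_{θ_{k-1}^t} and q_k^t the role of Q_{θ_k^t}). If for every k ∈ {1, …, K} one has ‖g_{k-1}^0 − q_k^0‖ − ‖g_{k-1}^0 − q_k^1‖ ≥ ‖g_{k-1}^1 − g_{k-1}^0‖ (the decrease of the k-th approximation error after optimization is at least the displacement of the target), then ∑_{k=1}^K ‖g_{k-1}^1 − q_k^1‖² ≤ ∑_{k=1}^K ‖g_{k-1}^0 − q_k^0‖² (the sum of approximation errors does not increase). -/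

import Mathlib

/-- Proposition 1 (i-QN): if for every k the decrease of the k-th approximation
error after optimization is at least the displacement of the target, then the
sum of squared approximation errors does not increase. Here `g t k` plays the
role of the Bellman update `Γ*Q_{θ_k^t}` and `q t k` the role of `Q_{θ_{k+1}^t}`
(indices shifted to start at 0). -/
theorem iQN_sum_approx_errors_decreases
    {E : Type*} [SeminormedAddCommGroup E] [NormedSpace ℝ E]
    (K : ℕ) (hK : 1 ≤ K)
    (g q : Fin 2 → Fin K → E)
    (h : ∀ k : Fin K,
      ‖g 0 k - q 0 k‖ - ‖g 0 k - q 1 k‖ ≥ ‖g 1 k - g 0 k‖) :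
    ∑ k : Fin K, ‖g 1 k - q 1 k‖ ^ 2 ≤ ∑ k : Fin K, ‖g 0 k - q 0 k‖ ^ 2 := by
  refine Finset.sum_le_sum fun k _ => pow_le_pow_left₀ (norm_nonneg _) ?_ 2
  linarith [h k, norm_sub_le_norm_sub_add_norm_sub (g 1 k) (g 0 k) (q 1 k)]
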